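/- arXiv:1204.5985 — 2 statements merged into one kernel-verified Lean document; each statement's English description precedes it below -/
import Mathlib

section
/- For every a ∈ ℝ and t > 0, the function p(τ) = (e^{−a²τ/2}/√(πτ) − (a/√2)·erfc(a√τ/√2)) · (e^{−a²(t−τ)/2}/√(π(t−τ)) + (a/√2)·erfc(−a√(t−τ)/√2)) is nonnegative on (0,t) and satisfies ∫₀^t p(τ) dτ = 1. -/
open Real MeasureTheory

/-- The complementary error function. -/
noncomputable def erfc (x : ℝ) : ℝ :=
  (2 / Real.sqrt π) * ∫ u in Set.Ioi x, Real.exp (-u^2)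

namespace Aka

open Set

/-- extension of a real function by zero to the negative axis, valued in `ENNReal` -/
noncomputable def ext0 (u : ℝ → ℝ) : ℝ → ENNReal :=
  (Ioi (0:ℝ)).indicator (fun x => ENNReal.ofReal (u x))

lemma measurable_ext0 {u : ℝ → ℝ} (hu : Measurable u) : Measurable (ext0 u) :=
  (hu.ennreal_ofReal).indicator measurableSet_Ioi

lemma conv_eq {u v w : ℝ → ℝ} (hu : ∀ x, 0 < x → 0 ≤ u x) (hv : ∀ x, 0 < x → 0 ≤ v x)
    (hi : ∀ t, 0 < t → IntervalIntegrable (fun y => u y * v (t - y)) volume 0 t)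
    (hw : ∀ t, 0 < t → ∫ y in (0:ℝ)..t, u y * v (t - y) = w t) :
    lconvolution (ext0 u) (ext0 v) volume = ext0 w := by
  ext t
  rw [lconvolution_def]
  have key : ∀ y, ext0 u y * ext0 v (-y + t)
      = (Ioo 0 t).indicator (fun y => ENNReal.ofReal (u y * v (t - y))) y := by
    intro y
    unfold ext0
    by_cases h1 : 0 < y
    · by_cases h2 : y < t
      · rw [indicator_of_mem (show y ∈ Ioi (0:ℝ) from h1),
          indicator_of_mem (show -y + t ∈ Ioi (0:ℝ) by simp; linarith),
          indicator_of_mem (show y ∈ Ioo 0 t from ⟨h1, h2⟩), ENNReal.ofReal_mul (hu y h1),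
          neg_add_eq_sub]
      · rw [indicator_of_notMem (show -y + t ∉ Ioi (0:ℝ) by simp; linarith),
          indicator_of_notMem (show y ∉ Ioo 0 t from fun h => h2 h.2), mul_zero]
    · rw [indicator_of_notMem (show y ∉ Ioi (0:ℝ) from h1),
          indicator_of_notMem (show y ∉ Ioo 0 t from fun h => h1 h.1), zero_mul]
  simp_rw [key]
  rw [lintegral_indicator measurableSet_Ioo]
  by_cases ht : 0 < t
  · have h2 := hi t ht
    rw [intervalIntegrable_iff_integrableOn_Ioo_of_le ht.le] at h2
    rw [ext0, indicator_of_mem (show t ∈ Ioi (0:ℝ) from ht), ← hw t ht,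
      intervalIntegral.integral_of_le ht.le, integral_Ioc_eq_integral_Ioo,
      ofReal_integral_eq_lintegral_ofReal h2]
    filter_upwards [ae_restrict_mem measurableSet_Ioo] with y hy
    exact mul_nonneg (hu y hy.1) (hv _ (by linarith [hy.2]))
  · rw [ext0, indicator_of_notMem (show t ∉ Ioi (0:ℝ) from ht), Ioo_eq_empty ht]
    simp

lemma ext0_inj {u v : ℝ → ℝ} (h : ext0 u = ext0 v) {t : ℝ} (ht : 0 < t) (hu : 0 ≤ u t)
    (hv : 0 ≤ v t) : u t = v t := by
  have := congrFun h t
  rw [ext0, ext0, indicator_of_mem (show t ∈ Ioi (0:ℝ) from ht),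
    indicator_of_mem (show t ∈ Ioi (0:ℝ) from ht)] at this
  exact (ENNReal.ofReal_eq_ofReal_iff hu hv).1 this

noncomputable def hh (c x : ℝ) : ℝ := exp (-c^2 * x) / √(π * x)
noncomputable def psi (c x : ℝ) : ℝ := (2 / √π) * ∫ u in (0:ℝ)..√x, exp (-c^2 * u^2)
noncomputable def ee (c x : ℝ) : ℝ := exp (-c^2 * x)
noncomputable def e1 (c x : ℝ) : ℝ := ∫ s in (0:ℝ)..x, ee c s
noncomputable def e2 (c x : ℝ) : ℝ := ∫ s in (0:ℝ)..x, e1 c s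

lemma hh_nonneg (c x : ℝ) : 0 ≤ hh c x := by unfold hh; positivity
lemma hh_meas (c : ℝ) : Measurable (hh c) := by unfold hh; fun_prop
lemma ee_cont (c : ℝ) : Continuous (ee c) := by unfold ee; fun_prop
lemma ee_nonneg (c x : ℝ) : 0 ≤ ee c x := by unfold ee; positivity
lemma e1_deriv (c x : ℝ) : HasDerivAt (e1 c) (ee c x) x :=
  (ee_cont c).integral_hasStrictDerivAt 0 x |>.hasDerivAt
lemma e1_cont (c : ℝ) : Continuous (e1 c) :=
  continuous_iff_continuousAt.2 fun x => (e1_deriv c x).continuousAt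
lemma e1_nonneg (c x : ℝ) (hx : 0 < x) : 0 ≤ e1 c x :=
  intervalIntegral.integral_nonneg hx.le fun u _ => ee_nonneg c u
lemma e2_nonneg (c x : ℝ) (hx : 0 < x) : 0 ≤ e2 c x := by
  refine intervalIntegral.integral_nonneg hx.le fun u hu => ?_
  exact intervalIntegral.integral_nonneg hu.1 fun u _ => ee_nonneg c u

lemma e1_eq (c x : ℝ) : c^2 * e1 c x = 1 - ee c x := by
  have h : ∀ y ∈ uIcc 0 x, HasDerivAt (fun y => - ee c y) (c^2 * ee c y) y := by
    intro y _
    have := (((hasDerivAt_id y).const_mul (-c^2)).exp).neg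
    refine this.congr_deriv ?_
    simp [ee]; ring
  have := intervalIntegral.integral_eq_sub_of_hasDerivAt h
    ((continuous_const.mul (ee_cont c)).intervalIntegrable _ _)
  rw [intervalIntegral.integral_const_mul] at this
  rw [e1, this]; simp [ee]; ring

lemma e2_eq (c x : ℝ) : c^2 * e2 c x = x - e1 c x := by
  rw [e2, ← intervalIntegral.integral_const_mul]
  simp_rw [e1_eq]
  rw [intervalIntegral.integral_sub (by simp) ((ee_cont c).intervalIntegrable _ _)]
  simp [e1]

lemma gint_cont (c : ℝ) : Continuous (fun z : ℝ => ∫ u in (0:ℝ)..z, exp (-c^2 * u^2)) :=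
  continuous_iff_continuousAt.2 fun x =>
    ((show Continuous (fun u : ℝ => exp (-c^2 * u^2)) by fun_prop).integral_hasStrictDerivAt
      0 x).hasDerivAt.continuousAt

lemma psi_cont (c : ℝ) : Continuous (psi c) :=
  continuous_const.mul ((gint_cont c).comp continuous_sqrt)

lemma psi_nonneg (c x : ℝ) : 0 ≤ psi c x := by
  unfold psi
  exact mul_nonneg (by positivity)
    (intervalIntegral.integral_nonneg (sqrt_nonneg x) fun u _ => (exp_pos _).le)

lemma psi_deriv (c x : ℝ) (hx : 0 < x) : HasDerivAt (psi c) (hh c x) x := by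
  have h1 := ((show Continuous (fun u : ℝ => exp (-c^2 * u^2)) by
    fun_prop).integral_hasStrictDerivAt 0 (√x)).hasDerivAt
  have h2 := (h1.comp x (hasDerivAt_sqrt hx.ne')).const_mul (2 / √π)
  refine h2.congr_deriv ?_
  rw [hh, sq_sqrt hx.le, sqrt_mul pi_pos.le]
  have : √x ≠ 0 := (sqrt_pos.2 hx).ne'
  have : √π ≠ 0 := (sqrt_pos.2 pi_pos).ne'
  field_simp

lemma hh_int (c t : ℝ) (ht : 0 < t) : IntervalIntegrable (hh c) volume 0 t := by
  refine intervalIntegral.intervalIntegrable_deriv_of_nonneg (g := psi c)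
    (psi_cont c).continuousOn ?_ ?_
  · intro x hx
    rw [min_eq_left ht.le, max_eq_right ht.le] at hx
    exact psi_deriv c x hx.1
  · intro x _
    exact hh_nonneg c x

lemma hh_integral (c t : ℝ) (ht : 0 < t) : ∫ y in (0:ℝ)..t, hh c y = psi c t := by
  rw [intervalIntegral.integral_eq_sub_of_hasDerivAt_of_le ht.le (psi_cont c).continuousOn
    (fun x hx => psi_deriv c x hx.1) (hh_int c t ht)]
  simp [psi]

lemma asin_deriv (c t y : ℝ) (hy : y ∈ Ioo 0 t) :
    HasDerivAt (fun y => ee c t / π * arcsin (2 * y / t - 1)) (hh c y * hh c (t - y)) y := by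
  have h1 : 0 < y := hy.1
  have h2 : 0 < t - y := by linarith [hy.2]
  have ht : 0 < t := by linarith
  have ha : 2 * y / t - 1 ≠ -1 := by
    have : 0 < 2 * y / t := by positivity
    linarith
  have hb : 2 * y / t - 1 ≠ 1 := by
    have : 2 * y / t < 2 := by rw [div_lt_iff₀ ht]; linarith
    linarith
  have h3 : HasDerivAt (fun y : ℝ => 2 * y / t - 1) (2 / t) y := by
    have := (((hasDerivAt_id y).const_mul 2).div_const t).sub_const 1
    simpa using this
  have h4 := ((hasDerivAt_arcsin ha hb).comp y h3).const_mul (ee c t / π)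
  refine h4.congr_deriv ?_
  have e : 1 - (2 * y / t - 1)^2 = (2 / t)^2 * (y * (t - y)) := by field_simp; ring
  rw [e, sqrt_mul (by positivity), sqrt_sq (by positivity), sqrt_mul h1.le, hh, hh,
    sqrt_mul pi_pos.le, sqrt_mul pi_pos.le]
  have e2 : ee c t = exp (-c^2 * y) * exp (-c^2 * (t - y)) := by
    rw [ee, ← exp_add]; congr 1; ring
  rw [e2]
  have s1 : √y ≠ 0 := (sqrt_pos.2 h1).ne'
  have s2 : √(t - y) ≠ 0 := (sqrt_pos.2 h2).ne'
  have s3 : √π ≠ 0 := (sqrt_pos.2 pi_pos).ne'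
  have s4 : π = √π * √π := (mul_self_sqrt pi_pos.le).symm
  rw [div_mul_div_comm (exp (-c^2 * y)) (√π * √y), show √π * √y * (√π * √(t - y)) = (√π * √π) * (√y * √(t-y)) by ring,
    ← s4]
  field_simp

lemma asin_cont (c t : ℝ) : Continuous (fun y => ee c t / π * arcsin (2 * y / t - 1)) := by
  have := continuous_arcsin
  fun_prop

lemma hhh_int (c t : ℝ) (ht : 0 < t) :
    IntervalIntegrable (fun y => hh c y * hh c (t - y)) volume 0 t := by
  refine intervalIntegral.intervalIntegrable_deriv_of_nonneg
    (asin_cont c t).continuousOn ?_ ?_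
  · intro x hx
    rw [min_eq_left ht.le, max_eq_right ht.le] at hx
    exact asin_deriv c t x hx
  · intro x _
    exact mul_nonneg (hh_nonneg c x) (hh_nonneg c _)

lemma hhh_integral (c t : ℝ) (ht : 0 < t) :
    ∫ y in (0:ℝ)..t, hh c y * hh c (t - y) = ee c t := by
  rw [intervalIntegral.integral_eq_sub_of_hasDerivAt_of_le ht.le (asin_cont c t).continuousOn
    (fun x hx => asin_deriv c t x hx) (hhh_int c t ht)]
  have : 2 * t / t - 1 = 1 := by field_simp; norm_num
  rw [this]
  simp
  field_simp
  norm_num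

lemma hpsi_int (c t : ℝ) (ht : 0 < t) :
    IntervalIntegrable (fun y => hh c y * psi c (t - y)) volume 0 t :=
  (hh_int c t ht).mul_continuousOn
    ((psi_cont c).comp (continuous_const.sub continuous_id)).continuousOn

lemma ppsi_int (c t : ℝ) :
    IntervalIntegrable (fun y => psi c y * psi c (t - y)) volume 0 t :=
  ((psi_cont c).mul ((psi_cont c).comp (continuous_const.sub continuous_id))).intervalIntegrable _ _

lemma convs (c t : ℝ) (ht : 0 < t) :
    (∫ y in (0:ℝ)..t, hh c y * psi c (t - y) = e1 c t) ∧
    (∫ y in (0:ℝ)..t, psi c y * psi c (t - y) = e2 c t) := by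
  have one : ∀ x : ℝ, 0 < x → (0:ℝ) ≤ (fun _ : ℝ => (1:ℝ)) x := fun _ _ => zero_le_one
  have hn : ∀ x : ℝ, 0 < x → 0 ≤ hh c x := fun x _ => hh_nonneg c x
  have pn : ∀ x : ℝ, 0 < x → 0 ≤ psi c x := fun x _ => psi_nonneg c x
  have H1 : lconvolution (ext0 (hh c)) (ext0 (hh c)) volume = ext0 (ee c) :=
    conv_eq hn hn (hhh_int c) (hhh_integral c)
  have H2 : lconvolution (ext0 (hh c)) (ext0 fun _ => 1) volume = ext0 (psi c) :=
    conv_eq hn one (by simpa using hh_int c) (by simpa using hh_integral c)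
  have H3 : lconvolution (ext0 (ee c)) (ext0 fun _ => 1) volume = ext0 (e1 c) :=
    conv_eq (fun x _ => ee_nonneg c x) one
      (fun t _ => by simpa using (ee_cont c).intervalIntegrable 0 t) (by simp [e1])
  have H4 : lconvolution (ext0 (e1 c)) (ext0 fun _ => 1) volume = ext0 (e2 c) :=
    conv_eq (e1_nonneg c) one
      (fun t _ => by simpa using (e1_cont c).intervalIntegrable 0 t) (by simp [e2])
  have H5 : lconvolution (ext0 (hh c)) (ext0 (psi c)) volume
      = ext0 (fun t => ∫ y in (0:ℝ)..t, hh c y * psi c (t - y)) :=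
    conv_eq hn pn (hpsi_int c) (fun _ _ => rfl)
  have H6 : lconvolution (ext0 (psi c)) (ext0 (psi c)) volume
      = ext0 (fun t => ∫ y in (0:ℝ)..t, psi c y * psi c (t - y)) :=
    conv_eq pn pn (fun t _ => ppsi_int c t) (fun _ _ => rfl)
  have mh := measurable_ext0 (hh_meas c)
  have mp := measurable_ext0 (psi_cont c).measurable
  have m1 : Measurable (ext0 fun _ => 1) := measurable_ext0 measurable_const
  have K1 : lconvolution (ext0 (hh c)) (ext0 (psi c)) volume = ext0 (e1 c) := by
    rw [← H2, lconvolution_assoc mh mh m1, H1, H3]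
  have K2 : lconvolution (ext0 (psi c)) (ext0 (psi c)) volume = ext0 (e2 c) := by
    conv_lhs => enter [1]; rw [← H2]
    rw [← lconvolution_assoc mh m1 mp, lconvolution_comm (f := ext0 fun _ => 1),
      lconvolution_assoc mh mp m1, K1, H4]
  constructor
  · refine ext0_inj (H5.symm.trans K1) ht ?_ (e1_nonneg c t ht)
    exact intervalIntegral.integral_nonneg ht.le fun u _ =>
      mul_nonneg (hh_nonneg c u) (psi_nonneg c _)
  · refine ext0_inj (H6.symm.trans K2) ht ?_ (e2_nonneg c t ht)
    exact intervalIntegral.integral_nonneg ht.le fun u _ =>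
      mul_nonneg (psi_nonneg c u) (psi_nonneg c _)

lemma gauss_int : Integrable (fun u : ℝ => exp (-u^2)) := by
  simpa using integrable_exp_neg_mul_sq (b := 1) one_pos

lemma erfc_eq (c x : ℝ) : erfc (c * √x) = 1 - c * psi c x := by
  have h := intervalIntegral.integral_interval_add_Ioi (a := 0) (b := c * √x)
    gauss_int.integrableOn gauss_int.integrableOn
  have g : ∫ u in Ioi (0:ℝ), exp (-u^2) = √π / 2 := by
    simpa using integral_gaussian_Ioi 1
  have s := intervalIntegral.mul_integral_comp_mul_left (a := 0) (b := √x)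
    (f := fun u : ℝ => exp (-u^2)) (c := c)
  have s2 : ∀ u : ℝ, -(c * u)^2 = -c^2 * u^2 := fun u => by ring
  simp only [s2, mul_zero] at s
  rw [g, ← s] at h
  have h' : ∫ u in Ioi (c * √x), exp (-u^2)
    = √π / 2 - c * ∫ u in (0:ℝ)..√x, exp (-c^2 * u^2) := by linarith
  have s3 : √π ≠ 0 := (sqrt_pos.2 pi_pos).ne'
  rw [erfc, h', psi]
  field_simp

lemma erfc_nonneg (z : ℝ) : 0 ≤ erfc z := by
  unfold erfc
  exact mul_nonneg (by positivity) (integral_nonneg fun u => (exp_pos _).le)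

lemma gauss_tail (z : ℝ) : ∫ u in Ioi z, u * exp (-u^2) = exp (-z^2) / 2 := by
  have hi : Integrable (fun u : ℝ => u * exp (-u^2)) := by
    simpa using integrable_mul_exp_neg_mul_sq (b := 1) one_pos
  have := integral_Ioi_of_hasDerivAt_of_tendsto' (a := z) (m := 0)
    (f := fun u : ℝ => -(exp (-u^2) / 2)) (f' := fun u : ℝ => u * exp (-u^2)) ?_
    hi.integrableOn ?_
  · rw [this]; ring
  · intro u _
    have := (((hasDerivAt_pow 2 u).neg.exp).div_const 2).neg
    refine this.congr_deriv ?_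
    simp; ring
  · have h1 : Filter.Tendsto (fun u : ℝ => -u^2) Filter.atTop Filter.atBot :=
      Filter.tendsto_neg_atTop_atBot.comp (Filter.tendsto_pow_atTop two_ne_zero)
    simpa using ((tendsto_exp_atBot.comp h1).div_const 2).neg

lemma mills (z : ℝ) (hz : 0 < z) : z * erfc z ≤ exp (-z^2) / √π := by
  have hi : Integrable (fun u : ℝ => u * exp (-u^2)) := by
    simpa using integrable_mul_exp_neg_mul_sq (b := 1) one_pos
  have h : ∫ u in Ioi z, z * exp (-u^2) ≤ ∫ u in Ioi z, u * exp (-u^2) := by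
    refine setIntegral_mono_on (gauss_int.const_mul z).integrableOn hi.integrableOn
      measurableSet_Ioi fun u hu => ?_
    exact mul_le_mul_of_nonneg_right (le_of_lt hu) (exp_pos _).le
  rw [gauss_tail, integral_const_mul] at h
  calc z * erfc z = (2 / √π) * (z * ∫ u in Ioi z, exp (-u^2)) := by rw [erfc]; ring
    _ ≤ (2 / √π) * (exp (-z^2) / 2) := mul_le_mul_of_nonneg_left h (by positivity)
    _ = _ := by ring

lemma factor_nonneg (c x : ℝ) (hx : 0 < x) : 0 ≤ hh c x - c * erfc (c * √x) := by
  have s0 : 0 < √x := sqrt_pos.2 hx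
  rcases le_or_gt c 0 with hc | hc
  · have := mul_nonneg (neg_nonneg.2 hc) (erfc_nonneg (c * √x))
    have := hh_nonneg c x
    linarith
  · have h := mills (c * √x) (by positivity)
    rw [mul_pow, sq_sqrt hx.le] at h
    have : c * erfc (c * √x) ≤ hh c x := by
      rw [hh, sqrt_mul pi_pos.le, ← div_div, le_div_iff₀ s0, neg_mul]
      linarith
    linarith

end Aka

/-- Akahori's occupation-time density for Brownian motion with
constant drift is nonnegative on `(0,t)` and has unit mass. -/
theorem stmt8 (a t : ℝ) (ht : 0 < t)
    (p : ℝ → ℝ)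
    (hp : p = fun τ =>
      (Real.exp (-a^2 * τ / 2) / Real.sqrt (π * τ) -
        (a / Real.sqrt 2) * erfc (a * Real.sqrt τ / Real.sqrt 2)) *
      (Real.exp (-a^2 * (t - τ) / 2) / Real.sqrt (π * (t - τ)) +
        (a / Real.sqrt 2) * erfc (-a * Real.sqrt (t - τ) / Real.sqrt 2))) :
    (∀ τ ∈ Set.Ioo (0:ℝ) t, 0 ≤ p τ) ∧ ∫ τ in (0:ℝ)..t, p τ = 1 := by
  obtain ⟨c, hc⟩ : ∃ c, c = a / √2 := ⟨_, rfl⟩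
  have c2 : ∀ x, -a^2 * x / 2 = -c^2 * x := by
    intro x
    rw [hc, div_pow, sq_sqrt (by norm_num)]; ring
  have hneg : ∀ x, Aka.hh (-c) x = Aka.hh c x := fun x => by simp [Aka.hh]
  have pneg : ∀ x, Aka.psi (-c) x = Aka.psi c x := fun x => by simp [Aka.psi]
  have hp1 : ∀ τ, p τ = (Aka.hh c τ - c * erfc (c * √τ)) *
      (Aka.hh (-c) (t - τ) - (-c) * erfc ((-c) * √(t - τ))) := by
    intro τ
    rw [hneg, hp]
    simp only [c2, Aka.hh, ← hc]
    rw [show a * √τ / √2 = c * √τ by rw [hc]; ring,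
      show -a * √(t - τ) / √2 = -c * √(t - τ) by rw [hc]; ring]
    ring
  constructor
  · intro τ hτ
    rw [hp1]
    exact mul_nonneg (Aka.factor_nonneg c τ hτ.1)
      (Aka.factor_nonneg (-c) (t - τ) (by linarith [hτ.2]))
  have hp2 : ∀ τ, p τ = Aka.hh c τ * Aka.hh c (t - τ)
      + c^2 * (Aka.hh c τ * Aka.psi c (t - τ))
      + c^2 * (Aka.hh c (t - τ) * Aka.psi c (t - (t - τ)))
      + c^4 * (Aka.psi c τ * Aka.psi c (t - τ))
      + c * (Aka.hh c τ + c^2 * Aka.psi c τ)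
      - c * (Aka.hh c (t - τ) + c^2 * Aka.psi c (t - τ)) - c^2 := by
    intro τ
    rw [hp1, Aka.erfc_eq, Aka.erfc_eq, hneg, pneg, sub_sub_cancel]
    ring
  have flip : ∀ f : ℝ → ℝ, IntervalIntegrable f volume 0 t →
      IntervalIntegrable (fun y => f (t - y)) volume 0 t := by
    intro f hf
    have := (hf.comp_sub_left t).symm
    simpa using this
  have I1 := Aka.hhh_int c t ht
  have I2 := (Aka.hpsi_int c t ht).const_mul (c^2)
  have I3 := (flip _ (Aka.hpsi_int c t ht)).const_mul (c^2)
  have I4 := (Aka.ppsi_int c t).const_mul (c^4)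
  have I5' : IntervalIntegrable (fun y => Aka.hh c y + c^2 * Aka.psi c y) volume 0 t :=
    (Aka.hh_int c t ht).add (((Aka.psi_cont c).intervalIntegrable _ _).const_mul _)
  have I5 := I5'.const_mul c
  have I6 := (flip _ I5').const_mul c
  have F : ∀ f : ℝ → ℝ, ∫ y in (0:ℝ)..t, f (t - y) = ∫ y in (0:ℝ)..t, f y := by
    intro f
    simp
  have F3 := F (fun y => Aka.hh c y * Aka.psi c (t - y))
  have F6 := F (fun y => Aka.hh c y + c^2 * Aka.psi c y)
  simp_rw [hp2]
  rw [intervalIntegral.integral_sub (((((I1.add I2).add I3).add I4).add I5).sub I6) (by simp),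
    intervalIntegral.integral_sub ((((I1.add I2).add I3).add I4).add I5) I6,
    intervalIntegral.integral_add (((I1.add I2).add I3).add I4) I5,
    intervalIntegral.integral_add ((I1.add I2).add I3) I4,
    intervalIntegral.integral_add (I1.add I2) I3,
    intervalIntegral.integral_add I1 I2]
  simp only [intervalIntegral.integral_const_mul]
  rw [F3, F6, (Aka.convs c t ht).1, (Aka.convs c t ht).2, Aka.hhh_integral c t ht]
  have k1 := Aka.e1_eq c t
  have k2 := Aka.e2_eq c t
  simp only [intervalIntegral.integral_const, smul_eq_mul, sub_zero]
  linear_combination k1 + c^2 * k2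
end

section
/- For τ > 0, a_L < 0 and a_R ≥ −a_L: (1/√2) ∫₀^∞ [ (a_L(z+τ) − (a_L+a_R)τ)/(z+τ)^{3/2} ] · e^{−(a_L z − a_R τ)²/(2(z+τ))} · erfc((a_L+a_R)√(zτ)/√(2(z+τ))) dz = −√π · e^{a_L²τ/2} e^{−a_R²τ/2} · erfc(−a_L√τ/√2). -/
open Real MeasureTheory

open Filter Topology

lemma aux_gi : Integrable (fun u : ℝ => Real.exp (-u^2)) := by
  have := integrable_exp_neg_mul_sq (b := 1) one_pos
  simpa using this

lemma erfc_eq (x : ℝ) : erfc x = 1 - (2 / √π) * ∫ u in (0:ℝ)..x, Real.exp (-u^2) := by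
  have h := intervalIntegral.integral_interval_add_Ioi (a := 0) (b := x)
    (f := fun u : ℝ => Real.exp (-u^2)) (μ := volume) aux_gi.integrableOn aux_gi.integrableOn
  have h2 := integral_gaussian_Ioi 1
  simp only [neg_mul, one_mul, div_one] at h2
  have hp : √π ≠ 0 := by positivity
  unfold erfc
  have : ∫ u in Set.Ioi x, Real.exp (-u^2) = √π / 2 - ∫ u in (0:ℝ)..x, Real.exp (-u^2) := by
    linarith
  rw [this]; field_simp

lemma erfc_hasDerivAt (x : ℝ) : HasDerivAt erfc (-(2 / √π) * Real.exp (-x^2)) x := by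
  have h : HasDerivAt (fun x => ∫ u in (0:ℝ)..x, Real.exp (-u^2)) (Real.exp (-x^2)) x := by
    have hc : Continuous (fun u : ℝ => Real.exp (-u^2)) := by fun_prop
    exact (intervalIntegral.integral_hasDerivAt_right
      (hc.intervalIntegrable _ _) (hc.stronglyMeasurableAtFilter _ _) hc.continuousAt)
  have h2 := (h.const_mul (2 / √π)).const_sub 1
  rw [show erfc = fun x => 1 - (2 / √π) * ∫ u in (0:ℝ)..x, Real.exp (-u^2) from funext erfc_eq]
  refine h2.congr_deriv ?_
  ring

lemma erfc_continuous : Continuous erfc :=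
  continuous_iff_continuousAt.2 fun x => (erfc_hasDerivAt x).continuousAt

lemma erfc_tendsto : Tendsto erfc atTop (𝓝 0) := by
  have h := intervalIntegral_tendsto_integral_Ioi 0 (aux_gi.integrableOn) tendsto_id
  have h2 := integral_gaussian_Ioi 1
  simp only [neg_mul, one_mul, div_one] at h2
  rw [h2] at h
  have h3 := (h.const_mul (2 / √π)).const_sub 1
  have hp : √π ≠ 0 := by positivity
  rw [show erfc = fun x => 1 - (2 / √π) * ∫ u in (0:ℝ)..x, Real.exp (-u^2) from funext erfc_eq]
  rw [show (1:ℝ) - 2 / √π * (√π / 2) = 0 by field_simp; ring] at h3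
  exact h3

lemma erfc_zero : erfc 0 = 1 := by simp [erfc_eq]

lemma erfc_nonneg (x : ℝ) : 0 ≤ erfc x := by
  unfold erfc
  have : 0 ≤ ∫ u in Set.Ioi x, Real.exp (-u^2) := integral_nonneg fun u => (Real.exp_pos _).le
  positivity

lemma erfc_le_one (x : ℝ) (hx : 0 ≤ x) : erfc x ≤ 1 := by
  rw [erfc_eq]
  have : 0 ≤ ∫ u in (0:ℝ)..x, Real.exp (-u^2) :=
    intervalIntegral.integral_nonneg hx fun u _ => (Real.exp_pos _).le
  have : 0 ≤ (2 / √π) * ∫ u in (0:ℝ)..x, Real.exp (-u^2) := by positivity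
  linarith

lemma aux_int (p w : ℝ) (hw : 0 < w) : Integrable (fun c : ℝ => Real.exp (p * c - c^2 * w / 2)) := by
  have h := ((integrable_exp_neg_mul_sq (b := w / 2) (by positivity)).comp_sub_right (p / w)).const_mul
    (Real.exp (p^2 / (2 * w)))
  refine h.congr (Eventually.of_forall fun c => ?_)
  simp only
  rw [← Real.exp_add]
  congr 1
  field_simp
  ring

lemma aux_int_mul (p w α : ℝ) (hα : 0 < α) (hw : 0 < w) :
    IntegrableOn (fun c : ℝ => c * Real.exp (p * c - c^2 * w / 2)) (Set.Ioi α) := by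
  refine Integrable.mono' (aux_int (p+1) w hw).integrableOn (by fun_prop) ?_
  refine (ae_restrict_iff' measurableSet_Ioi).2 (Eventually.of_forall fun c hc => ?_)
  have hc : 0 < c := lt_trans hα hc
  rw [Real.norm_of_nonneg (by positivity)]
  have : c ≤ Real.exp c := by linarith [Real.add_one_le_exp c]
  calc _ ≤ Real.exp c * Real.exp (p * c - c^2 * w / 2) := by gcongr
    _ = _ := by rw [← Real.exp_add]; congr 1; ring

lemma aux_exp_tendsto (p w : ℝ) (hw : 0 < w) :
    Tendsto (fun c : ℝ => Real.exp (p * c - c^2 * w / 2)) atTop (𝓝 0) := by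
  refine Real.tendsto_exp_atBot.comp ?_
  have h1 : Tendsto (fun c : ℝ => c * (w / 2) - p) atTop atTop :=
    tendsto_atTop_add_const_right _ _ (tendsto_id.atTop_mul_const (by positivity))
  have h2 := tendsto_neg_atTop_atBot.comp (tendsto_id.atTop_mul_atTop₀ h1)
  refine h2.congr fun c => ?_
  simp; ring

lemma aux_deriv (p w c : ℝ) (hw : 0 < w) :
    HasDerivAt (fun c => -(Real.exp (p^2 / (2*w)) * √π / (√2 * √w) * erfc ((c * w - p) / (√2 * √w))))
      (Real.exp (p * c - c^2 * w / 2)) c := by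
  have h1 : HasDerivAt (fun c : ℝ => (c * w - p) / (√2 * √w)) (w / (√2 * √w)) c := by
    simpa using (((hasDerivAt_id c).mul_const w).sub_const p).div_const (√2 * √w)
  have h2 := (((erfc_hasDerivAt _).comp c h1).const_mul
    (Real.exp (p^2 / (2*w)) * √π / (√2 * √w))).neg
  refine h2.congr_deriv ?_
  have e1 : √2 * √2 = 2 := by norm_num
  have e2 : √w * √w = w := Real.mul_self_sqrt hw.le
  have e3 : Real.exp (p * c - c^2 * w / 2) = Real.exp (p^2/(2*w)) * Real.exp (-((c * w - p) / (√2 * √w))^2) := by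
    rw [← Real.exp_add]; congr 1
    rw [div_pow, mul_pow, Real.sq_sqrt hw.le, Real.sq_sqrt (by norm_num)]
    field_simp; ring
  rw [e3]
  have hp : √π ≠ 0 := by positivity
  have hq : √w ≠ 0 := by positivity
  field_simp
  rw [Real.sq_sqrt hw.le, Real.sq_sqrt (by norm_num)]

lemma aux_arg_tendsto (p w : ℝ) (hw : 0 < w) :
    Tendsto (fun c : ℝ => (c * w - p) / (√2 * √w)) atTop atTop :=
  (tendsto_atTop_add_const_right _ _ (tendsto_id.atTop_mul_const hw)).atTop_div_const (by positivity)

lemma aux_val (p w α : ℝ) (hw : 0 < w) :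
    ∫ c in Set.Ioi α, Real.exp (p * c - c^2 * w / 2) =
      Real.exp (p^2 / (2*w)) * √π / (√2 * √w) * erfc ((α * w - p) / (√2 * √w)) := by
  have ht := ((erfc_tendsto.comp (aux_arg_tendsto p w hw)).const_mul
    (Real.exp (p^2 / (2*w)) * √π / (√2 * √w))).neg
  have := integral_Ioi_of_hasDerivAt_of_tendsto' (a := α) (fun c _ => aux_deriv p w c hw)
    (aux_int p w hw).integrableOn ht
  rw [this]; simp

lemma aux_val_mul (p w α : ℝ) (hα : 0 < α) (hw : 0 < w) :
    ∫ c in Set.Ioi α, c * Real.exp (p * c - c^2 * w / 2) =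
      (1 / w) * (Real.exp (p * α - α^2 * w / 2) + p *
      (Real.exp (p^2 / (2*w)) * √π / (√2 * √w) * erfc ((α * w - p) / (√2 * √w)))) := by
  rw [← aux_val p w α hw]
  have hd : ∀ c : ℝ, HasDerivAt (fun c : ℝ => Real.exp (p * c - c^2 * w / 2))
      (p * Real.exp (p * c - c^2 * w / 2) - w * (c * Real.exp (p * c - c^2 * w / 2))) c := by
    intro c
    have h1 : HasDerivAt (fun c : ℝ => p * c - c^2 * w / 2) (p - c * w) c := by
      have := ((hasDerivAt_id c).const_mul p).sub ((((hasDerivAt_id c).pow 2).mul_const w).div_const 2)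
      refine this.congr_deriv ?_
      simp; ring
    refine h1.exp.congr_deriv ?_
    ring
  have i1 : IntegrableOn (fun c : ℝ => p * Real.exp (p * c - c^2 * w / 2)) (Set.Ioi α) :=
    (aux_int p w hw).integrableOn.const_mul p
  have i2 : IntegrableOn (fun c : ℝ => w * (c * Real.exp (p * c - c^2 * w / 2))) (Set.Ioi α) :=
    (aux_int_mul p w α hα hw).const_mul w
  have := integral_Ioi_of_hasDerivAt_of_tendsto' (a := α) (fun c _ => hd c)
    (i1.sub i2) (aux_exp_tendsto p w hw)
  rw [integral_sub i1 i2, integral_const_mul, integral_const_mul] at this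
  rw [one_div, eq_inv_mul_iff_mul_eq₀ hw.ne']
  linarith

/-- Owen type function. -/
noncomputable def TT (p τ α r : ℝ) : ℝ :=
  ∫ c in Set.Ioi α, Real.exp (p * c - c^2 * τ / 2) * erfc (c * r)

lemma TT_meas (p τ α r : ℝ) : AEStronglyMeasurable
    (fun c : ℝ => Real.exp (p * c - c^2 * τ / 2) * erfc (c * r)) (volume.restrict (Set.Ioi α)) := by
  have := erfc_continuous
  exact Continuous.aestronglyMeasurable (by fun_prop)

lemma TT_bound (p τ α r : ℝ) (hα : 0 < α) (hr : 0 ≤ r) :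
    ∀ᵐ c ∂(volume.restrict (Set.Ioi α)), ‖Real.exp (p * c - c^2 * τ / 2) * erfc (c * r)‖
      ≤ Real.exp (p * c - c^2 * τ / 2) := by
  refine (ae_restrict_iff' measurableSet_Ioi).2 (Eventually.of_forall fun c hc => ?_)
  have hc : 0 < c := lt_trans hα hc
  have h0 := erfc_nonneg (c * r)
  have h1 := erfc_le_one (c * r) (by positivity)
  rw [Real.norm_of_nonneg (by positivity)]
  exact mul_le_of_le_one_right (by positivity) h1

lemma TT_zero (p τ α : ℝ) (hτ : 0 < τ) : TT p τ α 0 =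
    Real.exp (p^2 / (2*τ)) * √π / (√2 * √τ) * erfc ((α * τ - p) / (√2 * √τ)) := by
  rw [← aux_val p τ α hτ]
  simp [TT, erfc_zero]

lemma TT_tendsto (p τ α : ℝ) (hτ : 0 < τ) (hα : 0 < α) :
    Tendsto (TT p τ α) atTop (𝓝 0) := by
  have h : Tendsto (TT p τ α) atTop (𝓝 (∫ c in Set.Ioi α, (0:ℝ))) := by
    refine tendsto_integral_filter_of_dominated_convergence
      (fun c => Real.exp (p * c - c^2 * τ / 2))
      (Eventually.of_forall fun r => TT_meas p τ α r)
      ((eventually_ge_atTop 0).mono fun r hr => TT_bound p τ α r hα hr)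
      (aux_int p τ hτ).integrableOn ?_
    refine (ae_restrict_iff' measurableSet_Ioi).2 (Eventually.of_forall fun c hc => ?_)
    have hc : 0 < c := lt_trans hα hc
    have := (erfc_tendsto.comp (tendsto_id.const_mul_atTop hc)).const_mul
      (Real.exp (p * c - c^2 * τ / 2))
    simpa using this
  simpa using h

lemma TT_cont (p τ α r : ℝ) (hτ : 0 < τ) (hα : 0 < α) :
    ContinuousWithinAt (TT p τ α) (Set.Ici 0) r := by
  refine tendsto_integral_filter_of_dominated_convergence
      (fun c => Real.exp (p * c - c^2 * τ / 2))
      (Eventually.of_forall fun r => TT_meas p τ α r)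
      (eventually_nhdsWithin_of_forall fun r hr => TT_bound p τ α r hα hr)
      (aux_int p τ hτ).integrableOn ?_
  refine Eventually.of_forall fun c => ?_
  have := erfc_continuous
  have h : Continuous fun r => Real.exp (p * c - c^2 * τ / 2) * erfc (c * r) := by fun_prop
  exact (h.tendsto r).mono_left nhdsWithin_le_nhds

lemma TT_hasDerivAt (p τ α r : ℝ) (hτ : 0 < τ) (hα : 0 < α) (hr : 0 < r) :
    HasDerivAt (TT p τ α) (-(2 / √π) * ((1 / (τ + 2 * r^2)) *
      (Real.exp (p * α - α^2 * (τ + 2 * r^2) / 2) + p *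
      (Real.exp (p^2 / (2*(τ + 2 * r^2))) * √π / (√2 * √(τ + 2 * r^2)) *
        erfc ((α * (τ + 2 * r^2) - p) / (√2 * √(τ + 2 * r^2))))))) r := by
  rw [← aux_val_mul p (τ + 2 * r^2) α hα (by positivity), ← integral_const_mul]
  have hi : Integrable (fun c : ℝ => Real.exp (p * c - c^2 * τ / 2) * erfc (c * r))
      (volume.restrict (Set.Ioi α)) :=
    Integrable.mono' (aux_int p τ hτ).integrableOn (TT_meas p τ α r) (TT_bound p τ α r hα hr.le)
  have key := hasDerivAt_integral_of_dominated_loc_of_deriv_le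
    (μ := volume.restrict (Set.Ioi α)) (x₀ := r) (s := Set.univ)
    (F := fun r c => Real.exp (p * c - c^2 * τ / 2) * erfc (c * r))
    (F' := fun r c => Real.exp (p * c - c^2 * τ / 2) * (-(2 / √π) * Real.exp (-(c * r)^2) * c))
    (bound := fun c => (2 / √π) * (c * Real.exp (p * c - c^2 * τ / 2)))
    Filter.univ_mem
    (Eventually.of_forall fun r => TT_meas p τ α r) hi
    (Continuous.aestronglyMeasurable (by fun_prop)) ?_
    ((aux_int_mul p τ α hα hτ).const_mul _) ?_
  · refine key.2.congr_deriv ?_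
    congr 1
    ext c
    have : Real.exp (p * c - c^2 * (τ + 2 * r^2) / 2) =
      Real.exp (p * c - c^2 * τ / 2) * Real.exp (-(c * r)^2) := by
      rw [← Real.exp_add]; congr 1; ring
    rw [this]; ring
  · refine (ae_restrict_iff' measurableSet_Ioi).2 (Eventually.of_forall fun c hc x _ => ?_)
    have hc : 0 < c := lt_trans hα hc
    have h1 : Real.exp (-(c * x)^2) ≤ 1 := Real.exp_le_one_iff.2 (by nlinarith [sq_nonneg (c * x)])
    rw [show Real.exp (p * c - c^2 * τ / 2) * (-(2 / √π) * Real.exp (-(c * x)^2) * c) =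
      -((2 / √π) * (c * Real.exp (p * c - c^2 * τ / 2)) * Real.exp (-(c * x)^2)) by ring, norm_neg,
      Real.norm_of_nonneg (by positivity)]
    exact mul_le_of_le_one_right (by positivity) h1
  · refine Eventually.of_forall fun c x _ => ?_
    have h1 : HasDerivAt (fun x : ℝ => c * x) c x := by
      simpa using (hasDerivAt_id x).const_mul c
    exact ((erfc_hasDerivAt _).comp x h1).const_mul _

lemma G_deriv (α p τ z : ℝ) (hw : 0 < z + τ) :
    HasDerivAt (fun z => erfc ((α * (z + τ) - p) / (√2 * √(z + τ))))
      (-(2 / √π) * Real.exp (2 * α * p) * Real.exp (-(α * (z + τ) + p)^2 / (2 * (z + τ))) *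
        ((α * (z + τ) + p) / (2 * √2 * ((z + τ) * √(z + τ))))) z := by
  have hz : HasDerivAt (fun z : ℝ => z + τ) 1 z := (hasDerivAt_id z).add_const τ
  have h1 := ((hz.const_mul α).sub_const p).div ((hz.sqrt hw.ne').const_mul √2) (by positivity)
  refine ((erfc_hasDerivAt _).comp z h1).congr_deriv ?_
  have e : Real.exp (-((α * (z + τ) - p) / (√2 * √(z + τ)))^2) =
      Real.exp (2 * α * p) * Real.exp (-(α * (z + τ) + p)^2 / (2 * (z + τ))) := by
    rw [← Real.exp_add]; congr 1
    rw [div_pow, mul_pow, Real.sq_sqrt hw.le, Real.sq_sqrt (by norm_num)]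
    field_simp; ring
  simp only [Pi.div_apply, id]
  rw [e]
  have hk : √(2:ℝ)^2 = 2 := Real.sq_sqrt (by norm_num)
  obtain ⟨q, hq, hq2⟩ : ∃ q : ℝ, 0 < q ∧ z + τ = q^2 := ⟨√(z+τ), by positivity, (Real.sq_sqrt hw.le).symm⟩
  rw [hq2, Real.sqrt_sq hq.le]
  have hp : √π ≠ 0 := by positivity
  generalize √2 = k at *
  have hk0 : k ≠ 0 := by rintro rfl; norm_num at hk
  rw [← hk]
  field_simp
  rw [hk]
  ring

lemma E_deriv (s τ z : ℝ) (hτ : 0 < τ) (hz0 : 0 < z) :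
    HasDerivAt (fun z => erfc (s * (√z * √τ) / (√2 * √(z + τ))))
      (-(2 / √π) * Real.exp (- s^2 * τ / 2) * Real.exp ((s * τ)^2 / (2 * (z + τ))) *
        (s * √τ * τ / (2 * √2 * √z * ((z + τ) * √(z + τ))))) z := by
  have hw : 0 < z + τ := by positivity
  have hz : HasDerivAt (fun z : ℝ => z + τ) 1 z := (hasDerivAt_id z).add_const τ
  have h1 := ((((hasDerivAt_id z).sqrt hz0.ne').mul_const √τ).const_mul s).div
    ((hz.sqrt hw.ne').const_mul √2) (by positivity)
  refine ((erfc_hasDerivAt _).comp z h1).congr_deriv ?_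
  have e : Real.exp (-(s * (√z * √τ) / (√2 * √(z + τ)))^2) =
      Real.exp (- s^2 * τ / 2) * Real.exp ((s * τ)^2 / (2 * (z + τ))) := by
    rw [← Real.exp_add]; congr 1
    rw [div_pow, mul_pow, mul_pow, mul_pow, Real.sq_sqrt hw.le, Real.sq_sqrt hz0.le,
      Real.sq_sqrt (by norm_num : (0:ℝ) ≤ 2), Real.sq_sqrt hτ.le]
    field_simp; ring
  simp only [Pi.div_apply, id]
  rw [e]
  have hk : √(2:ℝ)^2 = 2 := Real.sq_sqrt (by norm_num)
  obtain ⟨q, hq, hq2⟩ : ∃ q : ℝ, 0 < q ∧ z + τ = q^2 := ⟨√(z+τ), by positivity, (Real.sq_sqrt hw.le).symm⟩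
  obtain ⟨m, hm, hm2⟩ : ∃ q : ℝ, 0 < q ∧ z = q^2 := ⟨√z, by positivity, (Real.sq_sqrt hz0.le).symm⟩
  rw [hq2, Real.sqrt_sq hq.le, hm2, Real.sqrt_sq hm.le]
  have ht : τ = q^2 - m^2 := by linarith
  have hp : √π ≠ 0 := by positivity
  generalize √2 = k at *
  have hk0 : k ≠ 0 := by rintro rfl; norm_num at hk
  generalize Real.exp (- s^2 * τ / 2) = X
  generalize Real.exp ((s * τ)^2 / (2 * q^2)) = X'
  generalize √τ = t
  rw [ht]
  field_simp

lemma TTz_deriv (p τ α z : ℝ) (hτ : 0 < τ) (hα : 0 < α) (hz0 : 0 < z) :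
    HasDerivAt (fun z => TT p τ α (√z / √2))
     (-(2 / √π) * ((1 / (z + τ)) *
      (Real.exp (p * α - α^2 * (z + τ) / 2) + p *
      (Real.exp (p^2 / (2*(z + τ))) * √π / (√2 * √(z + τ)) *
        erfc ((α * (z + τ) - p) / (√2 * √(z + τ)))))) * (1 / (2 * √z) / √2)) z := by
  have h1 := ((hasDerivAt_id z).sqrt hz0.ne').div_const √2
  have h2 := (TT_hasDerivAt p τ α (√z / √2) hτ hα (by positivity)).comp z h1
  have e : τ + 2 * (√z / √2)^2 = z + τ := by
    rw [div_pow, Real.sq_sqrt hz0.le, Real.sq_sqrt (by norm_num)]; ring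
  rw [e] at h2
  exact h2

/-- The antiderivative. -/
noncomputable def Psi (s τ α z : ℝ) : ℝ :=
  √2 * √π * Real.exp (-(2 * α * (s * τ))) *
   (erfc ((α * (z + τ) - s * τ) / (√2 * √(z + τ))) * erfc (s * (√z * √τ) / (√2 * √(z + τ)))
     - Real.exp (- s^2 * τ / 2) * (√2 * √τ / √π) * TT (s * τ) τ α (√z / √2)
     + Real.exp (- s^2 * τ / 2) * (√2 * √τ / √π) * Real.exp (s * τ * α) * TT 0 τ α (√z / √2))

lemma Psi_deriv (s τ α z : ℝ) (hτ : 0 < τ) (hα : 0 < α) (hz0 : 0 < z) :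
    HasDerivAt (Psi s τ α)
      (-(α * (z + τ) + s * τ) / ((z + τ) * √(z + τ)) *
        Real.exp (-(α * (z + τ) + s * τ)^2 / (2 * (z + τ))) *
        erfc (s * (√z * √τ) / (√2 * √(z + τ)))) z := by
  have hw : 0 < z + τ := by positivity
  have h := ((((G_deriv α (s * τ) τ z hw).mul (E_deriv s τ z hτ hz0)).sub
    ((TTz_deriv (s * τ) τ α z hτ hα hz0).const_mul
      (Real.exp (- s^2 * τ / 2) * (√2 * √τ / √π)))).add
    ((TTz_deriv 0 τ α z hτ hα hz0).const_mul
      (Real.exp (- s^2 * τ / 2) * (√2 * √τ / √π) * Real.exp (s * τ * α)))).const_mul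
      (√2 * √π * Real.exp (-(2 * α * (s * τ))))
  refine HasDerivAt.congr_deriv (f := Psi s τ α) h ?_
  have hk : √(2:ℝ)^2 = 2 := Real.sq_sqrt (by norm_num)
  have e1 : Real.exp (s * τ * α - α^2 * (z + τ) / 2) =
      Real.exp (s * τ * α) * Real.exp (0 * α - α^2 * (z + τ) / 2) := by
    rw [← Real.exp_add]; congr 1; ring
  have e2 : Real.exp (2 * α * (s * τ)) = (Real.exp (-(2 * α * (s * τ))))⁻¹ := by
    rw [← Real.exp_neg, neg_neg]
  have hX : Real.exp (-(2 * α * (s * τ))) ≠ 0 := (Real.exp_pos _).ne'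
  rw [e1, e2]
  generalize Real.exp (-(2 * α * (s * τ))) = X at *
  generalize Real.exp (s * τ * α) = X1
  generalize Real.exp (0 * α - α^2 * (z + τ) / 2) = X2
  generalize Real.exp (- s^2 * τ / 2) = X3
  generalize Real.exp ((s * τ)^2 / (2*(z + τ))) = X4
  generalize Real.exp (-(α * (z + τ) + s * τ)^2 / (2 * (z + τ))) = X5
  generalize erfc (s * (√z * √τ) / (√2 * √(z + τ))) = Y1
  generalize erfc ((α * (z + τ) - s * τ) / (√2 * √(z + τ))) = Y2
  have hp : √π ≠ 0 := by positivity
  have hq : √(z + τ) ≠ 0 := by positivity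
  have hm : √z ≠ 0 := by positivity
  generalize √(z + τ) = q at *
  generalize √z = m at *
  generalize √π = c at *
  generalize √τ = t at *
  generalize √2 = k at *
  have hk0 : k ≠ 0 := by rintro rfl; norm_num at hk
  field_simp
  ring_nf

lemma Psi_cont (s τ α : ℝ) (hτ : 0 < τ) (hα : 0 < α) :
    ContinuousWithinAt (Psi s τ α) (Set.Ici 0) 0 := by
  have hc := erfc_continuous
  have hq : √2 * √(0 + τ) ≠ 0 := by rw [zero_add]; positivity
  have hT : ∀ p, ContinuousWithinAt (fun z => TT p τ α (√z / √2)) (Set.Ici 0) 0 := by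
    intro p
    have h1 : ContinuousWithinAt (fun z : ℝ => √z / √2) (Set.Ici 0) 0 := by
      apply Continuous.continuousWithinAt; fun_prop
    have h2 := TT_cont p τ α (√0 / √2) hτ hα
    exact ContinuousWithinAt.comp (f := fun z : ℝ => √z / √2) (x := 0) h2 h1 (fun z hz => by simp only [Set.mem_Ici]; positivity)
  have hA : ContinuousAt (fun z => (α * (z + τ) - s * τ) / (√2 * √(z + τ))) 0 :=
    ContinuousAt.div (by fun_prop) (by fun_prop) hq
  have hB : ContinuousAt (fun z => s * (√z * √τ) / (√2 * √(z + τ))) 0 :=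
    ContinuousAt.div (by fun_prop) (by fun_prop) hq
  have hA' := (hc.continuousAt.comp hA).continuousWithinAt (s := Set.Ici 0)
  have hB' := (hc.continuousAt.comp hB).continuousWithinAt (s := Set.Ici 0)
  exact (((hA'.mul hB').sub ((hT (s * τ)).const_mul _)).add ((hT 0).const_mul _)).const_mul _

lemma Psi_zero (s τ α : ℝ) (hτ : 0 < τ) : Psi s τ α 0 =
    √2 * √π * Real.exp (-(2 * α * (s * τ))) *
      (Real.exp (- s^2 * τ / 2) * Real.exp (s * τ * α) * erfc (α * √τ / √2)) := by
  unfold Psi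
  have e : Real.exp ((s * τ)^2 / (2 * τ)) = (Real.exp (- s^2 * τ / 2))⁻¹ := by
    rw [← Real.exp_neg]; congr 1; field_simp
  have e2 : α * τ / (√2 * √τ) = α * √τ / √2 := by
    have : √τ ≠ 0 := by positivity
    field_simp
    rw [Real.sq_sqrt hτ.le]
  simp only [Real.sqrt_zero, zero_div, zero_mul, mul_zero, erfc_zero, TT_zero _ τ α hτ, zero_add, e]
  simp only [sub_zero, e2]
  have hp : √π ≠ 0 := by positivity
  have ht : √τ ≠ 0 := by positivity
  have hX : Real.exp (- s^2 * τ / 2) ≠ 0 := (Real.exp_pos _).ne'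
  simp only [ne_eq, OfNat.ofNat_ne_zero, not_false_eq_true, zero_pow, zero_div, Real.exp_zero]
  field_simp
  ring

lemma Psi_tendsto (s τ α : ℝ) (hτ : 0 < τ) (hα : 0 < α) (hs : 0 ≤ s) :
    Tendsto (Psi s τ α) atTop (𝓝 0) := by
  have hr : Tendsto (fun z : ℝ => √z / √2) atTop atTop :=
    Real.tendsto_sqrt_atTop.atTop_div_const (by positivity)
  have hT : ∀ p, Tendsto (fun z => TT p τ α (√z / √2)) atTop (𝓝 0) := fun p =>
    (TT_tendsto p τ α hτ hα).comp hr
  have hw : Tendsto (fun z : ℝ => z + τ) atTop atTop := tendsto_atTop_add_const_right _ _ tendsto_id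
  have hA : Tendsto (fun z => (α * (z + τ) - s * τ) / (√2 * √(z + τ))) atTop atTop := by
    have h1 : Tendsto (fun w : ℝ => (α * √w) / √2 - s * τ / √2) atTop atTop :=
      tendsto_atTop_add_const_right _ _
        ((Real.tendsto_sqrt_atTop.const_mul_atTop hα).atTop_div_const (by positivity))
    have h2 : Tendsto (fun w : ℝ => (α * w - s * τ) / (√2 * √w)) atTop atTop := by
      refine tendsto_atTop_mono' _ ?_ h1
      filter_upwards [eventually_ge_atTop 1] with w hw
      have hq : 1 ≤ √w := Real.one_le_sqrt.2 hw
      obtain ⟨q, hq1, rfl⟩ : ∃ q : ℝ, 1 ≤ q ∧ w = q^2 := ⟨√w, hq, (Real.sq_sqrt (by linarith)).symm⟩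
      rw [Real.sqrt_sq (by linarith)]
      rw [← sub_div, div_mul_eq_div_div_swap]
      gcongr
      rw [le_div_iff₀ (by linarith)]
      have : 0 ≤ s * τ := by positivity
      nlinarith
    exact h2.comp hw
  have hGE : Tendsto (fun z => erfc ((α * (z + τ) - s * τ) / (√2 * √(z + τ))) *
      erfc (s * (√z * √τ) / (√2 * √(z + τ)))) atTop (𝓝 0) := by
    refine squeeze_zero (fun z => mul_nonneg (erfc_nonneg _) (erfc_nonneg _)) (fun z => ?_)
      (erfc_tendsto.comp hA)
    exact mul_le_of_le_one_right (erfc_nonneg _) (erfc_le_one _ (by positivity))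
  have := (((hGE.sub ((hT (s * τ)).const_mul (Real.exp (- s^2 * τ / 2) * (√2 * √τ / √π)))).add
    ((hT 0).const_mul (Real.exp (- s^2 * τ / 2) * (√2 * √τ / √π) * Real.exp (s * τ * α))))).const_mul
      (√2 * √π * Real.exp (-(2 * α * (s * τ))))
  simp only [mul_zero, sub_zero, add_zero] at this
  exact this

/-- integral identity for the long-time asymptotics. -/
theorem stmt11 (aL aR τ : ℝ) (hτ : 0 < τ) (hL : aL < 0) (hR : -aL ≤ aR) :
    (1 / Real.sqrt 2) *
      ∫ z in Set.Ioi (0:ℝ),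
        (aL * (z + τ) - (aL + aR) * τ) / (z + τ) ^ ((3:ℝ)/2) *
          Real.exp (-(aL * z - aR * τ)^2 / (2 * (z + τ))) *
          erfc ((aL + aR) * Real.sqrt (z * τ) / Real.sqrt (2 * (z + τ)))
    = -Real.sqrt π * Real.exp (aL^2 * τ / 2) * Real.exp (-aR^2 * τ / 2) *
        erfc (-aL * Real.sqrt τ / Real.sqrt 2) := by
  obtain ⟨α, rfl⟩ : ∃ α, aL = -α := ⟨-aL, by ring⟩
  obtain ⟨s, rfl⟩ : ∃ s, aR = s + α := ⟨aR - α, by ring⟩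
  have hα : 0 < α := by linarith
  have hs : 0 ≤ s := by linarith
  have key := integral_Ioi_of_hasDerivAt_of_nonpos (Psi_cont s τ α hτ hα)
    (fun z hz => Psi_deriv s τ α z hτ hα hz) (fun z hz => ?_) (Psi_tendsto s τ α hτ hα hs)
  · have hcongr : ∫ z in Set.Ioi (0:ℝ),
        (-α * (z + τ) - (-α + (s + α)) * τ) / (z + τ) ^ ((3:ℝ)/2) *
          Real.exp (-(-α * z - (s + α) * τ)^2 / (2 * (z + τ))) *
          erfc ((-α + (s + α)) * Real.sqrt (z * τ) / Real.sqrt (2 * (z + τ))) =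
        ∫ z in Set.Ioi (0:ℝ), (-(α * (z + τ) + s * τ) / ((z + τ) * √(z + τ)) *
        Real.exp (-(α * (z + τ) + s * τ)^2 / (2 * (z + τ))) *
        erfc (s * (√z * √τ) / (√2 * √(z + τ)))) := by
      refine setIntegral_congr_fun measurableSet_Ioi fun z hz => ?_
      have hz : 0 < z := hz
      have hw : 0 < z + τ := by positivity
      have e1 : (z + τ) ^ ((3:ℝ)/2) = (z + τ) * √(z + τ) := by
        rw [Real.sqrt_eq_rpow, show (3:ℝ)/2 = 1 + 1/2 by norm_num, Real.rpow_add hw, Real.rpow_one]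
      rw [e1, Real.sqrt_mul hz.le, Real.sqrt_mul (by norm_num : (0:ℝ) ≤ 2)]
      congr 2
      · congr 1; ring
      · congr 1; ring
      · ring
    rw [hcongr, key, Psi_zero s τ α hτ]
    have e : Real.exp ((-α)^2 * τ / 2) * Real.exp (-(s + α)^2 * τ / 2) =
        Real.exp (-(2 * α * (s * τ))) * (Real.exp (- s^2 * τ / 2) * Real.exp (s * τ * α)) := by
      simp only [← Real.exp_add]; congr 1; ring
    rw [neg_neg, mul_assoc (-√π), e]
    field_simp
    ring
  · have hz : 0 < z := hz
    have h0 := erfc_nonneg (s * (√z * √τ) / (√2 * √(z + τ)))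
    rw [neg_div, neg_mul, neg_mul, neg_nonpos]
    positivity
end
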